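/- Let r₀ > 0 and a > 0 with 6a ≤ r₀², and let ε ∈ {+1,−1}. Then for (ℓ,θ) ∈ ℝ × (0,π), the point (ℓ,θ) is a critical point of Ψ_ε (i.e., both partial derivatives ∂_ℓΨ_ε(ℓ,θ) and ∂_θΨ_ε(ℓ,θ) vanish) if and only if ℓ = 0 and θ = π/2. -/

import Mathlib

open Real

/-- Example 1 potential Ψ_ε(ℓ,θ) = −(ℓ² + r₀² + 2εa sin θ)/((ℓ²+r₀²)^{3/2} sin θ). -/
noncomputable def PsiEx1 (r₀ a ε ℓ θ : ℝ) : ℝ :=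
  -(ℓ ^ 2 + r₀ ^ 2 + 2 * ε * a * Real.sin θ) /
    (Real.sqrt (ℓ ^ 2 + r₀ ^ 2) ^ 3 * Real.sin θ)

/-- The `ℓ`-derivative of the potential, with `√(ℓ² + r₀²) ^ 5` for `(ℓ² + r₀²)^{5/2}`. -/
lemma hasDerivAt_PsiEx1_left {r₀ ℓ θ : ℝ} (a ε : ℝ) (hpos : 0 < ℓ ^ 2 + r₀ ^ 2)
    (hsin : sin θ ≠ 0) :
    HasDerivAt (fun x => PsiEx1 r₀ a ε x θ)
      (ℓ * (ℓ ^ 2 + r₀ ^ 2 + 6 * ε * a * sin θ) / (√(ℓ ^ 2 + r₀ ^ 2) ^ 5 * sin θ)) ℓ := by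
  have hs : √(ℓ ^ 2 + r₀ ^ 2) ≠ 0 := (sqrt_pos.mpr hpos).ne'
  have hsq : √(ℓ ^ 2 + r₀ ^ 2) ^ 2 = ℓ ^ 2 + r₀ ^ 2 := sq_sqrt hpos.le
  have hq : HasDerivAt (fun x : ℝ => x ^ 2 + r₀ ^ 2) (2 * ℓ) ℓ := by
    simpa using (hasDerivAt_pow 2 ℓ).add_const (r₀ ^ 2)
  have hnum := (hq.add_const (2 * ε * a * sin θ)).fun_neg
  have hden := ((hq.sqrt hpos.ne').fun_pow 3).mul_const (sin θ)
  refine (hnum.fun_div hden (mul_ne_zero (pow_ne_zero 3 hs) hsin)).congr_deriv ?_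
  generalize √(ℓ ^ 2 + r₀ ^ 2) = s at hs hsq ⊢
  rw [← hsq]
  field_simp
  ring

/-- The `θ`-derivative of the potential. -/
lemma hasDerivAt_PsiEx1_right {r₀ ℓ θ : ℝ} (a ε : ℝ) (hpos : 0 < ℓ ^ 2 + r₀ ^ 2)
    (hsin : sin θ ≠ 0) :
    HasDerivAt (fun ϑ => PsiEx1 r₀ a ε ℓ ϑ)
      (cos θ / (sin θ ^ 2 * √(ℓ ^ 2 + r₀ ^ 2))) θ := by
  have hs : √(ℓ ^ 2 + r₀ ^ 2) ≠ 0 := (sqrt_pos.mpr hpos).ne'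
  have hsq : √(ℓ ^ 2 + r₀ ^ 2) ^ 2 = ℓ ^ 2 + r₀ ^ 2 := sq_sqrt hpos.le
  have hnum := (((hasDerivAt_sin θ).const_mul (2 * ε * a)).const_add (ℓ ^ 2 + r₀ ^ 2)).fun_neg
  have hden := (hasDerivAt_sin θ).const_mul (√(ℓ ^ 2 + r₀ ^ 2) ^ 3)
  refine (hnum.fun_div hden (mul_ne_zero (pow_ne_zero 3 hs) hsin)).congr_deriv ?_
  generalize √(ℓ ^ 2 + r₀ ^ 2) = s at hs hsq ⊢
  rw [← hsq]
  field_simp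
  ring

/-- Example 1, case 6a ≤ r₀²: the only critical point of Ψ_ε on ℝ × (0,π) is the
photon circle at ℓ = 0, θ = π/2. -/
theorem example1_critical_points_small_a (r₀ a ε : ℝ) (hr₀ : 0 < r₀) (ha : 0 < a)
    (hcase : 6 * a ≤ r₀ ^ 2) (hε : ε = 1 ∨ ε = -1) (ℓ θ : ℝ)
    (hθ : θ ∈ Set.Ioo 0 π) :
    (deriv (fun x => PsiEx1 r₀ a ε x θ) ℓ = 0 ∧
     deriv (fun ϑ => PsiEx1 r₀ a ε ℓ ϑ) θ = 0) ↔ (ℓ = 0 ∧ θ = π / 2) := by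
  have hsin : 0 < sin θ := sin_pos_of_mem_Ioo hθ
  have hpos : 0 < ℓ ^ 2 + r₀ ^ 2 := by positivity
  have hs : 0 < √(ℓ ^ 2 + r₀ ^ 2) := sqrt_pos.mpr hpos
  rw [(hasDerivAt_PsiEx1_left a ε hpos hsin.ne').deriv,
    (hasDerivAt_PsiEx1_right a ε hpos hsin.ne').deriv, div_eq_zero_iff, div_eq_zero_iff,
    or_iff_left (by positivity), or_iff_left (by positivity)]
  constructor
  · rintro ⟨hℓ, hcos⟩
    have hθ_eq : θ = π / 2 :=
      injOn_cos ⟨hθ.1.le, hθ.2.le⟩ ⟨by positivity, by linarith [pi_pos]⟩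
        (by rw [hcos, cos_pi_div_two])
    refine ⟨?_, hθ_eq⟩
    rw [hθ_eq, sin_pi_div_two] at hℓ
    rcases mul_eq_zero.mp hℓ with h | h
    · exact h
    · rcases hε with rfl | rfl <;> nlinarith [sq_nonneg ℓ]
  · rintro ⟨rfl, rfl⟩
    simp
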